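/- arXiv:2501.12322 — 2 statements merged into one kernel-verified Lean document; each statement's English description precedes it below -/
import Mathlib

section
/- Let t ≥ 3 and let U_1, …, U_t be subspaces of V. Then the quantity dim A_k − dim C_k = dim( U_k ⊓ (⊔_{j ≠ k} U_j) ) − dim( ⊔_{ℓ ≠ k} ( U_k ⊓ (⊔_{j ∉ {k,ℓ}} U_j) ) ) is the same for every k ∈ {1,…,t}; that is, the bases B_{k(T∖{k})} of the subspace decomposition all have identical dimension. -/
open Module

/-- `A_k := U_k ⊓ (⊔_{j ≠ k} U_j)`. -/
def subA {F V : Type*} [Field F] [AddCommGroup V] [Module F V] {t : ℕ}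
    (U : Fin t → Submodule F V) (k : Fin t) : Submodule F V :=
  U k ⊓ (⨆ j : Fin t, ⨆ _ : j ≠ k, U j)

/-- `C_k := ⊔_{ℓ ≠ k} ( U_k ⊓ (⊔_{j ∉ {k,ℓ}} U_j) )`. -/
def subC {F V : Type*} [Field F] [AddCommGroup V] [Module F V] {t : ℕ}
    (U : Fin t → Submodule F V) (k : Fin t) : Submodule F V :=
  ⨆ l : Fin t, ⨆ _ : l ≠ k,
    (U k ⊓ (⨆ j : Fin t, ⨆ _ : j ≠ k ∧ j ≠ l, U j))

/-- Relations among the `U j`. -/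
def relS {F V : Type*} [Field F] [AddCommGroup V] [Module F V] {t : ℕ}
    (U : Fin t → Submodule F V) : Submodule F (Fin t → V) where
  carrier := {s | (∀ j, s j ∈ U j) ∧ ∑ j, s j = 0}
  zero_mem' := ⟨fun j => by simp, by simp⟩
  add_mem' := fun {a b} ha hb =>
    ⟨fun j => (U j).add_mem (ha.1 j) (hb.1 j), by simp [Finset.sum_add_distrib, ha.2, hb.2]⟩
  smul_mem' := fun c a ha =>
    ⟨fun j => (U j).smul_mem c (ha.1 j), by simp [← Finset.smul_sum, ha.2]⟩

theorem relS_aux {F V : Type*} [Field F] [AddCommGroup V] [Module F V] {t : ℕ}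
    (U : Fin t → Submodule F V) (k : Fin t) (p : Fin t → Prop) (hk : ¬ p k) (x : V) :
    x ∈ U k ⊓ (⨆ j : Fin t, ⨆ _ : p j, U j) ↔
      ∃ s ∈ relS U, (∀ j, j ≠ k → ¬ p j → s j = 0) ∧ s k = x := by
  classical
  constructor
  · rintro ⟨hx, hx2⟩
    obtain ⟨f, hf, hs⟩ := (Submodule.mem_iSup_iff_exists_finsupp _ _).1 hx2
    rw [Finsupp.sum_fintype _ _ (fun _ => rfl)] at hs
    have h0 : ∀ j, ¬ p j → f j = 0 := fun j hj => by
      have := hf j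
      simpa [hj] using this
    have h1 : ∀ j, f j ∈ U j := fun j => by
      have := hf j
      by_cases hj : p j
      · simpa [hj] using this
      · rw [h0 j hj]; exact zero_mem _
    refine ⟨(Pi.single k x : Fin t → V) - (fun j => f j), ⟨fun j => ?_, ?_⟩, fun j hj hpj => ?_, ?_⟩
    · refine sub_mem ?_ (h1 j)
      by_cases hj : j = k
      · subst hj; simpa using hx
      · simp [hj]
    · simp [Finset.sum_sub_distrib, hs]
    · simp [hj, h0 j hpj]
    · simp [h0 k hk]
  · rintro ⟨s, ⟨hs, hsum⟩, h0, rfl⟩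
    refine ⟨hs k, ?_⟩
    have : s k = - ∑ j ∈ Finset.univ.erase k, s j := by
      rw [← Finset.add_sum_erase _ _ (Finset.mem_univ k)] at hsum
      exact eq_neg_of_add_eq_zero_left hsum
    rw [this]
    refine neg_mem (Submodule.sum_mem _ fun j hj => ?_)
    by_cases hpj : p j
    · exact Submodule.mem_iSup_of_mem j (Submodule.mem_iSup_of_mem hpj (hs j))
    · rw [h0 j (Finset.ne_of_mem_erase hj) hpj]; exact zero_mem _

/-- Relations with vanishing `l`-th entry. -/
def relZ {F V : Type*} [Field F] [AddCommGroup V] [Module F V] {t : ℕ}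
    (U : Fin t → Submodule F V) (l : Fin t) : Submodule F (Fin t → V) :=
  relS U ⊓ LinearMap.ker (LinearMap.proj (R := F) (φ := fun _ : Fin t => V) l)

theorem subA_eq_map {F V : Type*} [Field F] [AddCommGroup V] [Module F V] {t : ℕ}
    (U : Fin t → Submodule F V) (k : Fin t) :
    subA U k = (relS U).map (LinearMap.proj (R := F) (φ := fun _ : Fin t => V) k) := by
  ext x
  unfold subA
  rw [relS_aux U k (fun j => j ≠ k) (by simp), Submodule.mem_map]
  constructor
  · rintro ⟨s, hs, -, h⟩
    exact ⟨s, hs, h⟩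
  · rintro ⟨s, hs, h⟩
    exact ⟨s, hs, fun j h1 h2 => absurd h1 h2, h⟩

theorem subC_eq_map {F V : Type*} [Field F] [AddCommGroup V] [Module F V] {t : ℕ}
    (U : Fin t → Submodule F V) (k : Fin t) :
    subC U k = (⨆ l, relZ U l).map (LinearMap.proj (R := F) (φ := fun _ : Fin t => V) k) := by
  have key : ∀ l, l ≠ k → (U k ⊓ (⨆ j : Fin t, ⨆ _ : j ≠ k ∧ j ≠ l, U j)) =
      (relZ U l).map (LinearMap.proj (R := F) (φ := fun _ : Fin t => V) k) := by
    intro l hl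
    ext x
    rw [relS_aux U k (fun j => j ≠ k ∧ j ≠ l) (by simp), Submodule.mem_map]
    constructor
    · rintro ⟨s, hs, h0, h⟩
      exact ⟨s, ⟨hs, h0 l hl (by simp)⟩, h⟩
    · rintro ⟨s, ⟨hs, h0⟩, h⟩
      refine ⟨s, hs, fun j h1 h2 => ?_, h⟩
      have : j = l := by
        by_contra hne
        exact h2 ⟨h1, hne⟩
      subst this
      exact h0
  unfold subC
  rw [Submodule.map_iSup]
  apply le_antisymm
  · refine iSup_le fun l => iSup_le fun hl => ?_
    rw [key l hl]
    exact le_iSup (fun l => (relZ U l).map (LinearMap.proj (R := F) (φ := fun _ : Fin t => V) k)) l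
  · refine iSup_le fun l => ?_
    by_cases hl : l = k
    · subst hl
      rintro x ⟨s, ⟨-, h0⟩, rfl⟩
      have h0' : LinearMap.proj (R := F) (φ := fun _ : Fin t => V) l s = 0 := h0
      rw [h0']
      exact zero_mem _
    · rw [← key l hl]
      exact le_iSup₂_of_le l hl le_rfl

theorem finrank_map_aux {F W V : Type*} [Field F] [AddCommGroup V] [Module F V]
    [AddCommGroup W] [Module F W] [FiniteDimensional F W] (f : W →ₗ[F] V) (S : Submodule F W) :
    finrank F (S.map f) + finrank F ↥(S ⊓ LinearMap.ker f) = finrank F S := by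
  have h := LinearMap.finrank_range_add_finrank_ker (f.domRestrict S)
  rw [LinearMap.range_domRestrict, LinearMap.ker_domRestrict] at h
  rw [← h, ← Submodule.map_comap_subtype,
    (Submodule.equivMapOfInjective S.subtype S.injective_subtype _).finrank_eq]

theorem stmt_3 (F V : Type*) [Field F] [AddCommGroup V] [Module F V]
    [FiniteDimensional F V] (t : ℕ) (ht : 3 ≤ t) (U : Fin t → Submodule F V)
    (k k' : Fin t) :
    (finrank F ↥(subA U k) : ℤ) - finrank F ↥(subC U k)
      = (finrank F ↥(subA U k') : ℤ) - finrank F ↥(subC U k') := by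
  have main : ∀ k, (finrank F ↥(subA U k) : ℤ) - finrank F ↥(subC U k) =
      (finrank F (relS U) : ℤ) - finrank F ↥(⨆ l, relZ U l) := by
    intro k
    have h1 := finrank_map_aux (LinearMap.proj (R := F) (φ := fun _ : Fin t => V) k) (relS U)
    have h2 := finrank_map_aux (LinearMap.proj (R := F) (φ := fun _ : Fin t => V) k)
      (⨆ l, relZ U l)
    have h3 : (⨆ l, relZ U l) ⊓
        LinearMap.ker (LinearMap.proj (R := F) (φ := fun _ : Fin t => V) k) =
        relS U ⊓ LinearMap.ker (LinearMap.proj (R := F) (φ := fun _ : Fin t => V) k) := by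
      apply le_antisymm
      · exact inf_le_inf_right _ (iSup_le fun l => inf_le_left)
      · exact le_inf (le_iSup (relZ U) k) inf_le_right
    rw [h3, ← subC_eq_map] at h2
    rw [← subA_eq_map] at h1
    omega
  rw [main k, main k']
end

section
/- Let t ≥ 3 and let U_1, …, U_t be subspaces of V. There exist subspaces W_1, …, W_t of V such that each W_k is an admissible complement at k, all W_k have the same dimension, and for every subset S ⊆ {1,…,t} with |S| = t − 1 the family (W_k)_{k ∈ S} is independent, i.e. dim(⊔_{k ∈ S} W_k) = Σ_{k ∈ S} dim W_k. -/
open Module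

/-- `W` is an admissible complement at `k`: `W ≤ A_k`, `W ⊓ C_k = 0`, `W ⊔ C_k = A_k`. -/
def IsAdmissibleComplement {F V : Type*} [Field F] [AddCommGroup V] [Module F V] {t : ℕ}
    (U : Fin t → Submodule F V) (k : Fin t) (W : Submodule F V) : Prop :=
  W ≤ subA U k ∧ W ⊓ subC U k = ⊥ ∧ W ⊔ subC U k = subA U k

theorem aux_mem_iSup {F V : Type*} [Field F] [AddCommGroup V] [Module F V] {t : ℕ}
    (U : Fin t → Submodule F V) (P : Fin t → Prop) (x : V) :
    x ∈ (⨆ j : Fin t, ⨆ _ : P j, U j) ↔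
      ∃ f : Fin t → V, (∀ j, f j ∈ U j) ∧ (∀ j, ¬ P j → f j = 0) ∧ ∑ j, f j = x := by
  constructor
  · intro hx
    rw [Submodule.mem_iSup_iff_exists_finsupp] at hx
    obtain ⟨f, hf, rfl⟩ := hx
    refine ⟨f, fun j => ?_, fun j hj => ?_, ?_⟩
    · exact (iSup_le (fun _ => le_rfl) : (⨆ _ : P j, U j) ≤ U j) (hf j)
    · have := hf j
      simpa [hj] using this
    · rw [Finsupp.sum_fintype _ _ (fun _ => rfl)]
  · rintro ⟨f, hf, h0, rfl⟩
    refine Submodule.sum_mem _ fun j _ => ?_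
    by_cases hj : P j
    · exact (le_iSup₂_of_le j hj le_rfl : U j ≤ _) (hf j)
    · rw [h0 j hj]; exact Submodule.zero_mem _

/-- The space of relations. -/
def relK {F V : Type*} [Field F] [AddCommGroup V] [Module F V] {t : ℕ}
    (U : Fin t → Submodule F V) : Submodule F (Fin t → V) where
  carrier := {r | (∀ j, r j ∈ U j) ∧ ∑ j, r j = 0}
  add_mem' := by
    rintro a b ⟨ha, ha'⟩ ⟨hb, hb'⟩
    exact ⟨fun j => (U j).add_mem (ha j) (hb j), by simp [Finset.sum_add_distrib, ha', hb']⟩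
  zero_mem' := ⟨fun j => (U j).zero_mem, by simp⟩
  smul_mem' := by
    rintro c a ⟨ha, ha'⟩
    exact ⟨fun j => (U j).smul_mem c (ha j), by simp [← Finset.smul_sum, ha']⟩

theorem aux_rel {F V : Type*} [Field F] [AddCommGroup V] [Module F V] {t : ℕ}
    (U : Fin t → Submodule F V) (k : Fin t) (P : Fin t → Prop) (hk : ¬ P k) (x : V) :
    x ∈ U k ⊓ (⨆ j : Fin t, ⨆ _ : P j, U j) ↔
      ∃ r ∈ relK U, (∀ j, j ≠ k → ¬ P j → r j = 0) ∧ r k = x := by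
  rw [Submodule.mem_inf, aux_mem_iSup]
  constructor
  · rintro ⟨hx, f, hf, h0, rfl⟩
    refine ⟨Pi.single k (∑ j, f j) - f, ⟨fun j => ?_, ?_⟩, fun j hj hP => ?_, ?_⟩
    · by_cases hj : j = k
      · subst hj
        simpa using (U j).sub_mem hx (hf j)
      · simpa [hj] using hf j
    · simp [Finset.sum_sub_distrib]
    · simp [hj, h0 j hP]
    · simp [h0 k hk]
  · rintro ⟨r, ⟨hr, hs⟩, h0, rfl⟩
    refine ⟨hr k, Pi.single k (r k) - r, fun j => ?_, fun j hP => ?_, ?_⟩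
    · by_cases hj : j = k
      · subst hj
        simp
      · simpa [hj] using hr j
    · by_cases hj : j = k
      · subst hj
        simp
      · simp [hj, h0 j hj hP]
    · simp [Finset.sum_sub_distrib, hs]

/-- Relations with some coordinate zero, summed. -/
def relN {F V : Type*} [Field F] [AddCommGroup V] [Module F V] {t : ℕ}
    (U : Fin t → Submodule F V) : Submodule F (Fin t → V) :=
  ⨆ l : Fin t, relK U ⊓ LinearMap.ker (LinearMap.proj (R := F) (φ := fun _ : Fin t => V) l)

theorem map_relK {F V : Type*} [Field F] [AddCommGroup V] [Module F V] {t : ℕ}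
    (U : Fin t → Submodule F V) (k : Fin t) :
    (relK U).map (LinearMap.proj (R := F) (φ := fun _ : Fin t => V) k) = subA U k := by
  ext x
  rw [subA, aux_rel U k (fun j => j ≠ k) (by simp), Submodule.mem_map]
  constructor
  · rintro ⟨r, hr, rfl⟩
    exact ⟨r, hr, fun j h h' => absurd h h', rfl⟩
  · rintro ⟨r, hr, -, rfl⟩
    exact ⟨r, hr, rfl⟩

theorem map_relN {F V : Type*} [Field F] [AddCommGroup V] [Module F V] {t : ℕ}
    (U : Fin t → Submodule F V) (k : Fin t) :
    (relN U).map (LinearMap.proj (R := F) (φ := fun _ : Fin t => V) k) = subC U k := by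
  rw [relN, Submodule.map_iSup, subC]
  congr 1
  funext l
  by_cases hl : l = k
  · subst hl
    simp only [ne_eq, not_true_eq_false, iSup_false]
    rw [eq_bot_iff]
    rintro _ ⟨r, ⟨_, hr⟩, rfl⟩
    exact hr
  · simp only [ne_eq, hl, not_false_eq_true, iSup_pos]
    ext x
    rw [aux_rel U k (fun j => ¬ j = k ∧ ¬ j = l) (by simp), Submodule.mem_map]
    constructor
    · rintro ⟨r, ⟨hr, h0⟩, rfl⟩
      refine ⟨r, hr, fun j h h' => ?_, rfl⟩
      have : j = l := by tauto
      subst this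
      exact h0
    · rintro ⟨r, hr, h0, rfl⟩
      exact ⟨r, ⟨hr, h0 l hl (by simp)⟩, rfl⟩

theorem stmt_4 (F V : Type*) [Field F] [AddCommGroup V] [Module F V]
    [FiniteDimensional F V] (t : ℕ) (ht : 3 ≤ t) (U : Fin t → Submodule F V) :
    ∃ W : Fin t → Submodule F V,
      (∀ k, IsAdmissibleComplement U k (W k)) ∧
      (∀ k k', finrank F ↥(W k) = finrank F ↥(W k')) ∧
      (∀ S : Finset (Fin t), S.card = t - 1 →
        finrank F ↥(⨆ k ∈ S, W k) = ∑ k ∈ S, finrank F ↥(W k)) := by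
  have hNK : relN U ≤ relK U := iSup_le fun l => inf_le_left
  obtain ⟨D₀, hD₀⟩ := Submodule.exists_isCompl (relN U)
  obtain ⟨D, hDK, hinf, hsup⟩ : ∃ D : Submodule F (Fin t → V),
      D ≤ relK U ∧ D ⊓ relN U = ⊥ ∧ D ⊔ relN U = relK U := by
    refine ⟨D₀ ⊓ relK U, inf_le_right, ?_, ?_⟩
    · rw [eq_bot_iff, ← hD₀.inf_eq_bot]
      exact le_inf inf_le_right (inf_le_left.trans inf_le_left)
    · rw [sup_comm, ← sup_inf_assoc_of_le _ hNK, hD₀.sup_eq_top, top_inf_eq]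
  have key : ∀ k, ∀ d ∈ D, ∀ n ∈ relN U, d k = n k → d = 0 := by
    intro k d hd n hn h
    have h1 : d - n ∈ relN U := by
      refine (le_iSup (fun l => relK U ⊓ LinearMap.ker
        (LinearMap.proj (R := F) (φ := fun _ : Fin t => V) l)) k) ⟨?_, ?_⟩
      · exact Submodule.sub_mem _ (hDK hd) (hNK hn)
      · simp [h]
    have h2 : d ∈ relN U := by simpa using Submodule.add_mem _ h1 hn
    have h3 : d ∈ D ⊓ relN U := ⟨hd, h2⟩
    rwa [hinf, Submodule.mem_bot] at h3
  let W : Fin t → Submodule F V := fun k =>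
    D.map (LinearMap.proj (R := F) (φ := fun _ : Fin t => V) k)
  have hadm : ∀ k, IsAdmissibleComplement U k (W k) := by
    intro k
    refine ⟨?_, ?_, ?_⟩
    · rw [← map_relK]
      exact Submodule.map_mono hDK
    · rw [← map_relN, eq_bot_iff]
      rintro _ ⟨⟨d, hd, rfl⟩, ⟨n, hn, h⟩⟩
      have := key k d hd n hn h.symm
      simp [this]
    · rw [← map_relN, ← map_relK, ← Submodule.map_sup, hsup]
  have hdim : ∀ k, finrank F ↥(W k) = finrank F ↥D := by
    intro k
    have hinj : Function.Injective
        ((LinearMap.proj (R := F) (φ := fun _ : Fin t => V) k).domRestrict D) := by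
      rw [← LinearMap.ker_eq_bot, LinearMap.ker_eq_bot']
      rintro ⟨d, hd⟩ h
      exact Subtype.ext (key k d hd 0 (Submodule.zero_mem _) h)
    have := LinearMap.finrank_range_of_inj hinj
    rwa [LinearMap.range_domRestrict] at this
  refine ⟨W, hadm, fun k k' => by rw [hdim, hdim], ?_⟩
  intro S hS
  obtain ⟨m, hm⟩ : ∃ m, m ∉ S := by
    by_contra! h
    have : S = Finset.univ := Finset.eq_univ_of_forall h
    rw [this, Finset.card_univ, Fintype.card_fin] at hS
    omega
  clear hS
  induction S using Finset.induction_on with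
  | empty => simp
  | insert k S hk ih =>
    rw [Finset.mem_insert, not_or] at hm
    rw [Finset.iSup_insert, Finset.sum_insert hk, ← ih hm.2,
      ← Submodule.finrank_sup_add_finrank_inf_eq]
    have hb : W k ⊓ (⨆ j ∈ S, W j) = ⊥ := by
      have hWU : ∀ j, W j ≤ U j := fun j => (hadm j).1.trans inf_le_left
      rw [eq_bot_iff, ← (hadm k).2.1]
      refine le_inf inf_le_left ?_
      refine le_trans ?_ (le_iSup₂_of_le m hm.1 le_rfl)
      refine inf_le_inf (hWU k) (iSup₂_le fun j hj => ?_)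
      refine (hWU j).trans (le_iSup₂_of_le j ⟨?_, ?_⟩ le_rfl)
      · rintro rfl; exact hk hj
      · rintro rfl; exact hm.2 hj
    rw [hb, finrank_bot, add_zero]
end
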